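/- Let σ, B₀, B₁ > 0 and let n, m be positive integers with m·B₁ < 1. For every z ∈ {−1,1}^{n+1}, let f^{(z)} : ℝ^m → ℝ^m be a smooth function such that |f^{(z)}_i(w)| ≤ B₀ and |∂f^{(z)}_i/∂w_j(w)| ≤ B₁ for all i, j ∈ [m] and all w ∈ ℝ^m. Let Z be uniform on {−1,1}^{n+1} and X uniform on {−1,1}^n, independent, and let W₀ ∼ N(0, σI_m) be independent of (Z,X). Let P⋆ be the law of W₀ + f^{(Z)}(W₀), and for each s ⊆ [n] let P⋆_s be the law of W₀ + f^{((X, p_s(X)))}(W₀). Then 2^{−n} ∑_{s⊆[n]} ‖P⋆ − P⋆_s‖₁ ≤ 2^{−n/2} · e^{2m B₀/√(2πσ)} / (1 − m B₁), where ‖P − Q‖₁ denotes twice the total variation distance between P and Q. -/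

import Mathlib

open MeasureTheory Finset
open scoped ENNReal

/-- The centered isotropic Gaussian measure `N(0, vI_m)` on `ℝ^m` (variance `v`). -/
noncomputable def gaussPi (m : ℕ) (v : ℝ) : Measure (Fin m → ℝ) :=
  Measure.pi fun _ => ProbabilityTheory.gaussianReal 0 v.toNNReal

/-- Total variation distance between two measures on a measurable space. -/
noncomputable def tvDist {α : Type*} [MeasurableSpace α] (P Q : Measure α) : ℝ :=
  ⨆ s : {s : Set α // MeasurableSet s}, |(P s.1).toReal - (Q s.1).toReal|

/-- Ostrowski's lower bound for the determinant of a small perturbation of the identity. -/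
theorem one_sub_card_mul_le_det_one_add {n : ℕ} (A : Matrix (Fin n) (Fin n) ℝ) {ε : ℝ}
    (hε : 0 ≤ ε) (hn : n * ε < 1) (hA : ∀ i j, |A i j| ≤ ε) :
    1 - n * ε ≤ (1 + A).det := by
  induction n generalizing ε with
  | zero => simp
  | succ n ih =>
    push_cast at hn ⊢
    have hε1 : ε < 1 := by nlinarith [mul_nonneg (Nat.cast_nonneg (α := ℝ) n) hε]
    have hpivot : 1 - ε ≤ 1 + A 0 0 := by linarith [(abs_le.1 (hA 0 0)).1]
    have hpos : 0 < 1 + A 0 0 := by linarith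
    set S : Matrix (Fin n) (Fin n) ℝ :=
      Matrix.of fun i j => A i.succ j.succ - A i.succ 0 / (1 + A 0 0) * A 0 j.succ
    have hdet : (1 + A).det = (1 + A 0 0) * (1 + S).det := by
      let c : Fin (n + 1) → ℝ := Fin.cons 0 fun i => A i.succ 0 / (1 + A 0 0)
      let B : Matrix (Fin (n + 1)) (Fin (n + 1)) ℝ :=
        Matrix.of fun i j => (1 + A) i j - c i * (1 + A) 0 j
      have hAB : (1 + A).det = B.det := by
        refine Matrix.det_eq_of_forall_row_eq_smul_add_const c 0 (by simp [c]) fun i j => ?_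
        simp [B, c]
      rw [hAB, Matrix.det_succ_column_zero, Fin.sum_univ_succ, Finset.sum_eq_zero]
      · have hsub : B.submatrix (Fin.succAbove 0) Fin.succ = 1 + S := by
          ext i j
          simp [B, c, S, Matrix.one_apply, add_sub_assoc, (Fin.succ_ne_zero j).symm]
        rw [hsub]
        simp [B, c]
      · intro i _
        have : B i.succ 0 = 0 := by
          simp [B, c, Matrix.one_apply]
          field_simp
          simp
        rw [this]
        simp
    have hδ : (n : ℝ) * (ε / (1 - ε)) < 1 := by
      rw [← mul_div_assoc, div_lt_one (by linarith)]
      linarith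
    have hSle : ∀ i j, |S i j| ≤ ε / (1 - ε) := by
      intro i j
      calc |S i j| ≤ |A i.succ j.succ| + |A i.succ 0 / (1 + A 0 0) * A 0 j.succ| := abs_sub _ _
        _ ≤ ε + ε / (1 - ε) * ε := by
            rw [abs_mul, abs_div, abs_of_pos hpos]
            gcongr <;> apply hA
        _ = ε / (1 - ε) := by
            have : 1 - ε ≠ 0 := by linarith
            field_simp
            ring
    have hdetS := ih S (div_nonneg hε (by linarith)) hδ hSle
    rw [hdet]
    calc 1 - (n + 1) * ε = (1 - ε) * (1 - n * (ε / (1 - ε))) := by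
          have : 1 - ε ≠ 0 := by linarith
          field_simp
          ring
      _ ≤ (1 + A 0 0) * (1 + S).det := by
          gcongr

theorem lintegral_pi_prod {n : ℕ} {E : Type*} [MeasurableSpace E] (μ : Fin n → Measure E)
    [∀ i, SigmaFinite (μ i)] {f : Fin n → E → ℝ≥0∞} (hf : ∀ i, Measurable (f i)) :
    ∫⁻ x, ∏ i, f i (x i) ∂Measure.pi μ = ∏ i, ∫⁻ t, f i t ∂μ i := by
  induction n with
  | zero => simp
  | succ n ih =>
    rw [(measurePreserving_piFinSuccAbove μ 0).symm.lintegral_map_equiv]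
    simp_rw [MeasurableEquiv.piFinSuccAbove_symm_apply, Fin.insertNthEquiv, Fin.prod_univ_succ]
    simp only [Equiv.coe_fn_mk, Fin.insertNth_zero, Fin.cons_zero, Fin.cons_succ,
      Fin.zero_succAbove]
    have hmeas : Measurable fun x : Fin n → E => ∏ i : Fin n, f i.succ (x i) := by
      have := fun i => hf i
      fun_prop
    refine (lintegral_prod_mul (hf 0).aemeasurable hmeas.aemeasurable).trans ?_
    rw [ih _ fun i => hf i.succ]

theorem pi_withDensity {n : ℕ} {E : Type*} [MeasurableSpace E] (μ : Fin n → Measure E)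
    [∀ i, SigmaFinite (μ i)] {f : Fin n → E → ℝ≥0∞} (hf : ∀ i, Measurable (f i))
    [∀ i, SigmaFinite ((μ i).withDensity (f i))] :
    Measure.pi (fun i => (μ i).withDensity (f i)) =
      (Measure.pi μ).withDensity fun x => ∏ i, f i (x i) := by
  refine Measure.pi_eq fun s hs => ?_
  rw [withDensity_apply _ (MeasurableSet.univ_pi hs), ← lintegral_indicator (.univ_pi hs)]
  have hind : (Set.univ.pi s).indicator (fun x => ∏ i, f i (x i)) =
      fun x => ∏ i, (s i).indicator (f i) (x i) := by
    ext x
    by_cases hx : x ∈ Set.univ.pi s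
    · rw [Set.indicator_of_mem hx]
      exact prod_congr rfl fun i _ => (Set.indicator_of_mem (hx i trivial) _).symm
    · obtain ⟨i, hi⟩ : ∃ i, x i ∉ s i := by simpa using hx
      rw [Set.indicator_of_notMem hx, prod_eq_zero (mem_univ i) (Set.indicator_of_notMem hi _)]
  rw [hind, lintegral_pi_prod μ fun i => (hf i).indicator (hs i)]
  exact prod_congr rfl fun i _ => by
    rw [withDensity_apply _ (hs i), lintegral_indicator (hs i)]

theorem sum_parity_mul_parity {n : ℕ} (x y : Fin n → ℤˣ) :
    ∑ s : Finset (Fin n), ((∏ i ∈ s, x i : ℤˣ) : ℝ) * ((∏ i ∈ s, y i : ℤˣ) : ℝ) =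
      if x = y then 2 ^ n else 0 := by
  have hprod : ∑ s : Finset (Fin n), ((∏ i ∈ s, x i : ℤˣ) : ℝ) * ((∏ i ∈ s, y i : ℤˣ) : ℝ) =
      ∏ i, (1 + ((x i : ℤ) : ℝ) * ((y i : ℤ) : ℝ)) := by
    rw [prod_one_add, powerset_univ]
    refine sum_congr rfl fun s _ => ?_
    rw [prod_mul_distrib]
    push_cast
    rfl
  rw [hprod]
  split_ifs with h
  · subst h
    have hterm : ∀ i, 1 + ((x i : ℤ) : ℝ) * ((x i : ℤ) : ℝ) = 2 := fun i => by
      rcases Int.units_eq_one_or (x i) with h | h <;> norm_num [h]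
    simp [hterm]
  · obtain ⟨i, hi⟩ := Function.ne_iff.1 h
    refine prod_eq_zero (mem_univ i) ?_
    rcases Int.units_eq_one_or (x i) with h1 | h1 <;>
      rcases Int.units_eq_one_or (y i) with h2 | h2 <;> simp_all

/-- Parseval's identity on the discrete cube. -/
theorem sum_sq_sum_parity_mul {n : ℕ} (h : (Fin n → ℤˣ) → ℝ) :
    ∑ s : Finset (Fin n), (∑ x : Fin n → ℤˣ, ((∏ i ∈ s, x i : ℤˣ) : ℝ) * h x) ^ 2 =
      2 ^ n * ∑ x, h x ^ 2 := by
  calc _ = ∑ s : Finset (Fin n), ∑ x : Fin n → ℤˣ, ∑ y : Fin n → ℤˣ,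
        ((∏ i ∈ s, x i : ℤˣ) : ℝ) * ((∏ i ∈ s, y i : ℤˣ) : ℝ) * (h x * h y) := by
        refine sum_congr rfl fun s _ => ?_
        rw [sq, sum_mul_sum]
        exact sum_congr rfl fun x _ => sum_congr rfl fun y _ => by ring
    _ = ∑ x : Fin n → ℤˣ, ∑ y : Fin n → ℤˣ, (if x = y then 2 ^ n else 0) * (h x * h y) := by
        rw [sum_comm]
        refine sum_congr rfl fun x _ => ?_
        rw [sum_comm]
        refine sum_congr rfl fun y _ => ?_
        rw [← sum_parity_mul_parity, sum_mul]
    _ = _ := by simp [mul_sum, sq]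

theorem sum_abs_sum_parity_mul_le {n : ℕ} {h : (Fin n → ℤˣ) → ℝ} (hh : ∀ x, |h x| ≤ 1) :
    ∑ s : Finset (Fin n), |∑ x : Fin n → ℤˣ, ((∏ i ∈ s, x i : ℤˣ) : ℝ) * h x| ≤
      2 ^ n * √(2 ^ n) := by
  refine le_of_abs_le (abs_le_of_sq_le_sq ?_ (by positivity))
  refine sq_sum_le_card_mul_sum_sq.trans ?_
  simp_rw [sq_abs]
  rw [sum_sq_sum_parity_mul, mul_pow, Real.sq_sqrt (by positivity)]
  have hsum : ∑ x, h x ^ 2 ≤ (2 : ℝ) ^ n := by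
    calc ∑ x, h x ^ 2 ≤ ∑ _x : Fin n → ℤˣ, (1 : ℝ) :=
          sum_le_sum fun x _ => (sq_le_one_iff_abs_le_one _).2 (hh x)
      _ = 2 ^ n := by simp
  have hcard : ((#(univ : Finset (Finset (Fin n))) : ℕ) : ℝ) = 2 ^ n := by simp
  rw [hcard, sq, mul_assoc]
  gcongr

/-- Averaged over all parities, a family of measures dominated by `ν` barely distinguishes a
random label from a parity label. -/
theorem sum_tvDist_parity_le {n : ℕ} {α : Type*} [MeasurableSpace α] (ν : Measure α)
    [IsFiniteMeasure ν] (μ : (Fin n → ℤˣ) × ℤˣ → Measure α) (hμ : ∀ z, μ z ≤ ν) :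
    (1 / 2 ^ n : ℝ) * ∑ s : Finset (Fin n),
        2 * tvDist (∑ z : (Fin n → ℤˣ) × ℤˣ, (2 ^ (n + 1) : ℝ≥0∞)⁻¹ • μ z)
          (∑ x : Fin n → ℤˣ, (2 ^ n : ℝ≥0∞)⁻¹ • μ (x, ∏ i ∈ s, x i)) ≤
      1 / √(2 ^ n) * ν.real Set.univ := by
  have hfin : ∀ z, IsFiniteMeasure (μ z) := fun z => isFiniteMeasure_of_le ν (hμ z)
  let g : (Fin n → ℤˣ) × ℤˣ → α → ℝ := fun z w => ((μ z).rnDeriv ν w).toReal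
  have hgi : ∀ z, Integrable (g z) ν := fun z => Measure.integrable_toReal_rnDeriv
  have hg : ∀ z A, ((μ z) A).toReal = ∫ w in A, g z w ∂ν := fun z A =>
    (Measure.setIntegral_toReal_rnDeriv (Measure.absolutelyContinuous_of_le (hμ z)) A).symm
  have hg1 : ∀ᵐ w ∂ν, ∀ z, g z w ≤ 1 := by
    rw [ae_all_iff]
    intro z
    filter_upwards [Measure.rnDeriv_le_one_of_le (hμ z)] with w hw
    exact ENNReal.toReal_mono ENNReal.one_ne_top hw
  let D : Finset (Fin n) → α → ℝ := fun s w =>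
    ∑ x : Fin n → ℤˣ, ((∏ i ∈ s, x i : ℤˣ) : ℝ) * (g (x, 1) w - g (x, -1) w)
  have hDi : ∀ s, Integrable (D s) ν := fun s =>
    integrable_finsetSum _ fun x _ => ((hgi _).sub (hgi _)).const_mul _
  have htv : ∀ s, tvDist (∑ z : (Fin n → ℤˣ) × ℤˣ, (2 ^ (n + 1) : ℝ≥0∞)⁻¹ • μ z)
      (∑ x : Fin n → ℤˣ, (2 ^ n : ℝ≥0∞)⁻¹ • μ (x, ∏ i ∈ s, x i)) ≤
        (2 ^ (n + 1))⁻¹ * ∫ w, |D s w| ∂ν := by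
    intro s
    have : Nonempty {A : Set α // MeasurableSet A} := ⟨⟨∅, .empty⟩⟩
    refine ciSup_le fun ⟨A, hA⟩ => ?_
    have hfinz : ∀ (c : ℝ≥0∞) (_ : c ≠ 0) z, c⁻¹ * (μ z) A ≠ ∞ := fun c hc z =>
      ENNReal.mul_ne_top (ENNReal.inv_ne_top.2 hc) (measure_ne_top _ _)
    have hDint : ∫ w in A, D s w ∂ν = ∑ x : Fin n → ℤˣ, ((∏ i ∈ s, x i : ℤˣ) : ℝ) *
        ((∫ w in A, g (x, 1) w ∂ν) - ∫ w in A, g (x, -1) w ∂ν) := by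
      refine (integral_finsetSum _ fun x _ =>
        (((hgi _).sub (hgi _)).const_mul _).integrableOn).trans ?_
      refine sum_congr rfl fun x _ => ?_
      rw [integral_const_mul, ← integral_sub (hgi _).integrableOn (hgi _).integrableOn]
      rfl
    have hdiff : ((∑ z : (Fin n → ℤˣ) × ℤˣ, (2 ^ (n + 1) : ℝ≥0∞)⁻¹ • μ z) A).toReal -
        ((∑ x : Fin n → ℤˣ, (2 ^ n : ℝ≥0∞)⁻¹ • μ (x, ∏ i ∈ s, x i)) A).toReal =
          -((2 ^ (n + 1))⁻¹ * ∫ w in A, D s w ∂ν) := by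
      simp only [Measure.finsetSum_apply, Measure.smul_apply, smul_eq_mul]
      rw [ENNReal.toReal_sum fun z _ => hfinz _ (by positivity) z,
        ENNReal.toReal_sum fun x _ => hfinz _ (by positivity) _, Fintype.sum_prod_type,
        hDint, ← sum_sub_distrib, mul_sum, ← sum_neg_distrib]
      refine sum_congr rfl fun x _ => ?_
      rw [UnitsInt.univ, sum_pair (by decide)]
      simp only [ENNReal.toReal_mul, ENNReal.toReal_inv, ENNReal.toReal_pow, ENNReal.toReal_ofNat,
        hg, pow_succ, mul_inv]
      rcases Int.units_eq_one_or (∏ i ∈ s, x i) with h | h <;> rw [h] <;> push_cast <;> ring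
    rw [hdiff, abs_neg, abs_mul, abs_of_pos (by positivity)]
    gcongr
    exact (abs_integral_le_integral_abs).trans
      (setIntegral_le_integral (hDi s).abs (.of_forall fun _ => abs_nonneg _))
  have hsum : ∑ s, ∫ w, |D s w| ∂ν ≤ 2 ^ n * √(2 ^ n) * ν.real Set.univ := by
    rw [← integral_finsetSum _ fun s _ => (hDi s).abs]
    calc ∫ w, ∑ s, |D s w| ∂ν ≤ ∫ _, 2 ^ n * √(2 ^ n) ∂ν := by
          refine integral_mono_ae (integrable_finsetSum _ fun s _ => (hDi s).abs)
            (integrable_const _) ?_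
          filter_upwards [hg1] with w hw
          refine sum_abs_sum_parity_mul_le fun x => abs_sub_le_of_nonneg_of_le ?_ (hw _) ?_ (hw _) <;>
            exact ENNReal.toReal_nonneg
      _ = _ := by rw [integral_const, smul_eq_mul, mul_comm]
  have hsq : √(2 ^ n : ℝ) * √(2 ^ n) = 2 ^ n := Real.mul_self_sqrt (by positivity)
  calc _ ≤ (1 / 2 ^ n : ℝ) * ∑ s : Finset (Fin n), 2 * ((2 ^ (n + 1))⁻¹ * ∫ w, |D s w| ∂ν) := by
        gcongr with s
        exact htv s
    _ = (1 / 2 ^ n) * ((2 ^ n)⁻¹ * ∑ s, ∫ w, |D s w| ∂ν) := by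
        simp only [mul_sum]
        refine sum_congr rfl fun s _ => ?_
        field_simp
        ring
    _ ≤ (1 / 2 ^ n) * ((2 ^ n)⁻¹ * (2 ^ n * √(2 ^ n) * ν.real Set.univ)) := by gcongr
    _ = 1 / √(2 ^ n) * ν.real Set.univ := by
        have : (√(2 ^ n : ℝ)) ≠ 0 := by positivity
        field_simp
        rw [sq, hsq]

/-- The supremum of the Gaussian density `N(0, v)` over a ball of radius `b` around `t`. -/
noncomputable def gaussEnvelope (b : ℝ) (v : NNReal) (t : ℝ) : ℝ≥0∞ :=
  ProbabilityTheory.gaussianPDF 0 v (max (|t| - b) 0)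

theorem measurable_gaussEnvelope (b : ℝ) (v : NNReal) : Measurable (gaussEnvelope b v) :=
  (ProbabilityTheory.measurable_gaussianPDF 0 v).comp (by fun_prop)

theorem gaussianPDF_anti_abs (v : NNReal) {x y : ℝ} (hxy : |x| ≤ |y|) :
    ProbabilityTheory.gaussianPDF 0 v y ≤ ProbabilityTheory.gaussianPDF 0 v x := by
  unfold ProbabilityTheory.gaussianPDF ProbabilityTheory.gaussianPDFReal
  have := sq_le_sq.2 hxy
  simp only [sub_zero]
  gcongr

theorem gaussianPDF_le_gaussEnvelope_add {b : ℝ} (v : NNReal) {u : ℝ} (hu : |u| ≤ b) (t : ℝ) :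
    ProbabilityTheory.gaussianPDF 0 v t ≤ gaussEnvelope b v (t + u) := by
  refine gaussianPDF_anti_abs v ?_
  rw [abs_of_nonneg (le_max_right _ _)]
  exact max_le (by linarith [abs_add_le t u]) (abs_nonneg t)

theorem gaussianPDF_zero (v : NNReal) :
    ProbabilityTheory.gaussianPDF 0 v 0 = ENNReal.ofReal (√(2 * Real.pi * v))⁻¹ := by
  simp [ProbabilityTheory.gaussianPDF, ProbabilityTheory.gaussianPDFReal]

theorem lintegral_gaussEnvelope_le {b : ℝ} (hb : 0 ≤ b) {v : NNReal} (hv : v ≠ 0) :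
    ∫⁻ t, gaussEnvelope b v t ≤ ENNReal.ofReal (Real.exp (2 * b / √(2 * Real.pi * v))) := by
  set φ := ProbabilityTheory.gaussianPDF 0 v with hφ
  have hcover : (Set.univ : Set ℝ) ⊆ (Set.Iio (-b) ∪ Set.Icc (-b) b) ∪ Set.Ioi b := fun t _ => by
    rcases lt_or_ge t (-b) with h | h
    · exact .inl (.inl h)
    · rcases le_or_gt t b with h' | h'
      · exact .inl (.inr ⟨h, h'⟩)
      · exact .inr h'
  have hleft : ∫⁻ t in Set.Iio (-b), gaussEnvelope b v t = ∫⁻ t in Set.Iio 0, φ t := by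
    have hpre : (fun t : ℝ => t + b) ⁻¹' Set.Iio 0 = Set.Iio (-b) := by
      ext t; simp [lt_neg_iff_add_neg]
    rw [← (measurePreserving_add_right volume b).setLIntegral_comp_preimage measurableSet_Iio
      (ProbabilityTheory.measurable_gaussianPDF 0 v), hpre]
    refine setLIntegral_congr_fun measurableSet_Iio fun t (ht : t < -b) => ?_
    refine le_antisymm (gaussianPDF_anti_abs v ?_) (gaussianPDF_anti_abs v ?_) <;>
      rw [abs_of_neg (by linarith : t < 0), abs_of_nonpos (by linarith : t + b ≤ 0),
        max_eq_left (by linarith), abs_of_nonneg (by linarith)] <;> linarith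
  have hright : ∫⁻ t in Set.Ioi b, gaussEnvelope b v t = ∫⁻ t in Set.Ioi 0, φ t := by
    have hpre : (fun t : ℝ => t + -b) ⁻¹' Set.Ioi 0 = Set.Ioi b := by
      ext t; simp
    rw [← (measurePreserving_add_right volume (-b)).setLIntegral_comp_preimage measurableSet_Ioi
      (ProbabilityTheory.measurable_gaussianPDF 0 v), hpre]
    refine setLIntegral_congr_fun measurableSet_Ioi fun t (ht : b < t) => ?_
    rw [gaussEnvelope, abs_of_pos (by linarith), max_eq_left (by linarith), sub_eq_add_neg]
  have hmid : ∫⁻ t in Set.Icc (-b) b, gaussEnvelope b v t ≤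
      ENNReal.ofReal (2 * b / √(2 * Real.pi * v)) := by
    calc ∫⁻ t in Set.Icc (-b) b, gaussEnvelope b v t ≤ ∫⁻ _ in Set.Icc (-b) b, φ 0 :=
          lintegral_mono fun t => gaussianPDF_anti_abs v (by simp)
      _ = ENNReal.ofReal (2 * b / √(2 * Real.pi * v)) := by
          rw [setLIntegral_const, Real.volume_Icc, hφ, gaussianPDF_zero,
            ← ENNReal.ofReal_mul (by positivity)]
          congr 1
          ring
  have htails : (∫⁻ t in Set.Iio 0, φ t) + ∫⁻ t in Set.Ioi 0, φ t ≤ 1 := by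
    rw [← lintegral_union measurableSet_Ioi Set.Iio_disjoint_Ioi_same,
      ← ProbabilityTheory.lintegral_gaussianPDF_eq_one 0 hv]
    exact setLIntegral_le_lintegral _ _
  calc ∫⁻ t, gaussEnvelope b v t
      ≤ ∫⁻ t in (Set.Iio (-b) ∪ Set.Icc (-b) b) ∪ Set.Ioi b, gaussEnvelope b v t := by
        rw [← setLIntegral_univ]
        exact lintegral_mono_set hcover
    _ ≤ (∫⁻ t in Set.Iio (-b), gaussEnvelope b v t) + (∫⁻ t in Set.Icc (-b) b, gaussEnvelope b v t)
          + ∫⁻ t in Set.Ioi b, gaussEnvelope b v t :=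
        (lintegral_union_le _ _ _).trans (by gcongr; exact lintegral_union_le _ _ _)
    _ ≤ 1 + ENNReal.ofReal (2 * b / √(2 * Real.pi * v)) := by
        rw [hleft, hright, add_right_comm]
        exact add_le_add htails hmid
    _ ≤ ENNReal.ofReal (Real.exp (2 * b / √(2 * Real.pi * v))) := by
        rw [← ENNReal.ofReal_one, ← ENNReal.ofReal_add zero_le_one (by positivity)]
        refine ENNReal.ofReal_le_ofReal ?_
        linarith [Real.add_one_le_exp (2 * b / √(2 * Real.pi * v))]

section Perturbation

variable {m : ℕ} {σ B₀ B₁ : ℝ} {f : (Fin m → ℝ) → Fin m → ℝ}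

theorem fderiv_apply_single_eq (hf : Differentiable ℝ f) (w : Fin m → ℝ) (i j : Fin m) :
    fderiv ℝ f w (Pi.single j 1) i = fderiv ℝ (fun w => f w i) w (Pi.single j 1) := by
  rw [fderiv_apply (hf w) i]
  rfl

theorem norm_fderiv_le_of_partial_le (hB₁ : 0 ≤ B₁) (hf : Differentiable ℝ f)
    (hderiv : ∀ w i j, |fderiv ℝ (fun w => f w i) w (Pi.single j 1)| ≤ B₁) (w : Fin m → ℝ) :
    ‖fderiv ℝ f w‖ ≤ m * B₁ := by
  refine ContinuousLinearMap.opNorm_le_bound _ (by positivity) fun v => ?_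
  refine (pi_norm_le_iff_of_nonneg (by positivity)).2 fun i => ?_
  have hv : fderiv ℝ f w v i = ∑ j, v j * fderiv ℝ f w (Pi.single j 1) i := by
    conv_lhs => rw [pi_eq_sum_univ' v]
    simp
  rw [hv]
  calc ‖∑ j, v j * fderiv ℝ f w (Pi.single j 1) i‖ ≤ ∑ _j : Fin m, ‖v‖ * B₁ := by
        refine norm_sum_le_of_le _ fun j _ => ?_
        rw [norm_mul, fderiv_apply_single_eq hf]
        exact mul_le_mul (norm_le_pi_norm v j) (hderiv w i j) (norm_nonneg _) (norm_nonneg _)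
    _ = m * B₁ * ‖v‖ := by
        simp
        ring

theorem injective_add_of_partial_le (hB₁ : 0 ≤ B₁) (hmB₁ : m * B₁ < 1) (hf : Differentiable ℝ f)
    (hderiv : ∀ w i j, |fderiv ℝ (fun w => f w i) w (Pi.single j 1)| ≤ B₁) :
    Function.Injective fun w => w + f w := by
  intro x y hxy
  have hlip : ‖f y - f x‖ ≤ m * B₁ * ‖y - x‖ :=
    convex_univ.norm_image_sub_le_of_norm_fderiv_le (fun w _ => hf w)
      (fun w _ => norm_fderiv_le_of_partial_le hB₁ hf hderiv w) trivial trivial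
  have hsub : f y - f x = -(y - x) := by
    have : x + f x = y + f y := hxy
    linear_combination -this
  rw [hsub, norm_neg] at hlip
  have : ‖y - x‖ = 0 := by nlinarith [norm_nonneg (y - x)]
  exact (sub_eq_zero.1 (norm_eq_zero.1 this)).symm

theorem one_sub_le_det_id_add_fderiv (hB₁ : 0 ≤ B₁) (hmB₁ : m * B₁ < 1) (hf : Differentiable ℝ f)
    (hderiv : ∀ w i j, |fderiv ℝ (fun w => f w i) w (Pi.single j 1)| ≤ B₁) (w : Fin m → ℝ) :
    1 - m * B₁ ≤ (ContinuousLinearMap.id ℝ (Fin m → ℝ) + fderiv ℝ f w).det := by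
  rw [ContinuousLinearMap.det, ← LinearMap.det_toMatrix']
  have hmat : LinearMap.toMatrix'
      ((ContinuousLinearMap.id ℝ (Fin m → ℝ) + fderiv ℝ f w : (Fin m → ℝ) →L[ℝ] (Fin m → ℝ)) :
        (Fin m → ℝ) →ₗ[ℝ] (Fin m → ℝ)) =
      1 + LinearMap.toMatrix' (fderiv ℝ f w : (Fin m → ℝ) →ₗ[ℝ] (Fin m → ℝ)) := by
    rw [← LinearMap.toMatrix'_id, ← map_add]
    rfl
  rw [hmat]
  refine one_sub_card_mul_le_det_one_add _ hB₁ hmB₁ fun i j => ?_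
  rw [LinearMap.toMatrix'_apply]
  exact (congrArg abs (fderiv_apply_single_eq hf w i j)).trans_le (hderiv w i j)

theorem gaussPi_eq_withDensity (m : ℕ) (hσ : 0 < σ) :
    gaussPi m σ =
      volume.withDensity fun w => ∏ i, ProbabilityTheory.gaussianPDF 0 σ.toNNReal (w i) := by
  have hσ' : σ.toNNReal ≠ 0 := (Real.toNNReal_pos.2 hσ).ne'
  have hG := ProbabilityTheory.gaussianReal_of_var_ne_zero 0 hσ'
  have : SigmaFinite (volume.withDensity (ProbabilityTheory.gaussianPDF 0 σ.toNNReal)) := by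
    rw [← hG]
    infer_instance
  rw [gaussPi, hG, volume_pi]
  exact pi_withDensity (fun _ : Fin m => volume)
    fun _ => ProbabilityTheory.measurable_gaussianPDF 0 σ.toNNReal

/-- The law of a perturbed Gaussian is dominated by a multiple of the product of the
envelopes of the one-dimensional Gaussian densities. -/
theorem map_add_gaussPi_le (hσ : 0 < σ) (hB₁ : 0 ≤ B₁) (hmB₁ : m * B₁ < 1)
    (hf : Differentiable ℝ f) (hval : ∀ w i, |f w i| ≤ B₀)
    (hderiv : ∀ w i j, |fderiv ℝ (fun w => f w i) w (Pi.single j 1)| ≤ B₁) :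
    Measure.map (fun w => w + f w) (gaussPi m σ) ≤
      ENNReal.ofReal (1 / (1 - m * B₁)) •
        volume.withDensity fun y => ∏ i, gaussEnvelope B₀ σ.toNNReal (y i) := by
  have hfm : Measurable f := hf.continuous.measurable
  have hpos : 0 < 1 - m * B₁ := by linarith
  refine Measure.le_iff.2 fun A hA => ?_
  set T : (Fin m → ℝ) → Fin m → ℝ := fun w => w + f w
  have hTm : Measurable T := measurable_id.add hfm
  have hpre : MeasurableSet (T ⁻¹' A) := hTm hA
  set Φ : (Fin m → ℝ) → ℝ≥0∞ := fun y => ∏ i, gaussEnvelope B₀ σ.toNNReal (y i)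
  let T' := fun w => ContinuousLinearMap.id ℝ (Fin m → ℝ) + fderiv ℝ f w
  rw [Measure.map_apply hTm hA, gaussPi_eq_withDensity m hσ, withDensity_apply _ hpre,
    Measure.smul_apply, smul_eq_mul, withDensity_apply _ hA]
  calc ∫⁻ w in T ⁻¹' A, ∏ i, ProbabilityTheory.gaussianPDF 0 σ.toNNReal (w i)
      ≤ ∫⁻ w in T ⁻¹' A, ENNReal.ofReal (1 / (1 - m * B₁)) *
          (ENNReal.ofReal |(T' w).det| * Φ (T w)) := by
        refine lintegral_mono fun w => ?_
        have hdet : 1 - m * B₁ ≤ |(T' w).det| :=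
          (one_sub_le_det_id_add_fderiv hB₁ hmB₁ hf hderiv w).trans (le_abs_self _)
        have hone : 1 ≤ ENNReal.ofReal (1 / (1 - m * B₁)) * ENNReal.ofReal |(T' w).det| := by
          rw [← ENNReal.ofReal_mul (by positivity), ENNReal.one_le_ofReal, one_div_mul_eq_div,
            one_le_div hpos]
          exact hdet
        calc ∏ i, ProbabilityTheory.gaussianPDF 0 σ.toNNReal (w i) ≤ Φ (T w) :=
              prod_le_prod' fun i _ => gaussianPDF_le_gaussEnvelope_add _ (hval w i) _
          _ = 1 * Φ (T w) := (one_mul _).symm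
          _ ≤ _ := by
              rw [← mul_assoc]
              gcongr
    _ = ENNReal.ofReal (1 / (1 - m * B₁)) *
          ∫⁻ w in T ⁻¹' A, ENNReal.ofReal |(T' w).det| * Φ (T w) :=
        lintegral_const_mul' _ _ ENNReal.ofReal_ne_top
    _ = ENNReal.ofReal (1 / (1 - m * B₁)) * ∫⁻ y in T '' (T ⁻¹' A), Φ y := by
        rw [lintegral_image_eq_lintegral_abs_det_fderiv_mul (f := T) (f' := T') volume hpre
          (fun w _ => ((hasFDerivAt_id w).add (hf w).hasFDerivAt).hasFDerivWithinAt)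
          (injective_add_of_partial_le hB₁ hmB₁ hf hderiv).injOn]
    _ ≤ ENNReal.ofReal (1 / (1 - m * B₁)) * ∫⁻ y in A, Φ y := by
        gcongr
        exact Set.image_preimage_subset T A

end Perturbation

theorem lintegral_prod_gaussEnvelope_le (m : ℕ) {b σ : ℝ} (hb : 0 ≤ b) (hσ : 0 < σ) :
    ∫⁻ y : Fin m → ℝ, ∏ i, gaussEnvelope b σ.toNNReal (y i) ≤
      ENNReal.ofReal (Real.exp (2 * m * b / √(2 * Real.pi * σ))) := by
  rw [volume_pi, lintegral_pi_prod _ fun _ => measurable_gaussEnvelope b σ.toNNReal, prod_const,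
    card_univ, Fintype.card_fin]
  refine (pow_le_pow_left' (lintegral_gaussEnvelope_le hb (Real.toNNReal_pos.2 hσ).ne') m).trans ?_
  rw [← ENNReal.ofReal_pow (Real.exp_pos _).le, ← Real.exp_nat_mul, Real.coe_toNNReal _ hσ.le]
  exact (congrArg (fun t => ENNReal.ofReal (Real.exp t)) (by ring)).le

/-- bounded smooth perturbations of a Gaussian cannot reveal a random parity.
`P⋆` is the law of `W₀ + f^{(Z)}(W₀)` with `Z` uniform on `{−1,1}^{n+1}` and
`W₀ ∼ N(0,σI_m)`; `P⋆_s` is the law of `W₀ + f^{((X,p_s(X)))}(W₀)` with `X` uniform on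
`{−1,1}^n`. Then `2^{−n}∑_s ‖P⋆ − P⋆_s‖₁ ≤ 2^{−n/2}·e^{2mB₀/√(2πσ)}/(1 − mB₁)`,
where `‖·‖₁` is twice the total variation distance (signs encoded as `ℤˣ = {±1}`). -/
theorem gaussian_perturbation_parity_bound (n m : ℕ) (hn : 1 ≤ n) (hm : 1 ≤ m)
    (σ B₀ B₁ : ℝ) (hσ : 0 < σ) (hB₀ : 0 < B₀) (hB₁ : 0 < B₁)
    (hmB₁ : (m : ℝ) * B₁ < 1)
    (f : (Fin n → ℤˣ) × ℤˣ → (Fin m → ℝ) → Fin m → ℝ)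
    (hsmooth : ∀ z, ContDiff ℝ (⊤ : ℕ∞) (f z))
    (hval : ∀ z w i, |f z w i| ≤ B₀)
    (hderiv : ∀ z w i j, |fderiv ℝ (fun w => f z w i) w (Pi.single j 1)| ≤ B₁) :
    (1 / 2 ^ n : ℝ) * ∑ s : Finset (Fin n),
        2 * tvDist
          (∑ z : (Fin n → ℤˣ) × ℤˣ, (2 ^ (n + 1) : ℝ≥0∞)⁻¹ •
            Measure.map (fun w => w + f z w) (gaussPi m σ))
          (∑ x : Fin n → ℤˣ, (2 ^ n : ℝ≥0∞)⁻¹ •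
            Measure.map (fun w => w + f (x, ∏ i ∈ s, x i) w) (gaussPi m σ))
      ≤ (1 / Real.sqrt (2 ^ n)) *
          Real.exp (2 * m * B₀ / Real.sqrt (2 * Real.pi * σ)) / (1 - m * B₁) := by
  set ν : Measure (Fin m → ℝ) := ENNReal.ofReal (1 / (1 - m * B₁)) •
    volume.withDensity fun y => ∏ i, gaussEnvelope B₀ σ.toNNReal (y i) with hν
  have hpos : 0 < 1 - m * B₁ := by linarith
  have hνle : ν Set.univ ≤
      ENNReal.ofReal (Real.exp (2 * m * B₀ / √(2 * Real.pi * σ)) / (1 - m * B₁)) := by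
    rw [hν, Measure.smul_apply, smul_eq_mul, withDensity_apply _ .univ, setLIntegral_univ,
      div_eq_mul_one_div (Real.exp _), mul_comm (Real.exp _), ENNReal.ofReal_mul (by positivity)]
    gcongr
    exact lintegral_prod_gaussEnvelope_le m hB₀.le hσ
  have : IsFiniteMeasure ν := ⟨hνle.trans_lt ENNReal.ofReal_lt_top⟩
  refine (sum_tvDist_parity_le ν _ fun z => map_add_gaussPi_le hσ hB₁.le hmB₁
    ((hsmooth z).differentiable (by simp)) (hval z) (hderiv z)).trans ?_
  rw [mul_div_assoc]
  gcongr
  exact ENNReal.toReal_le_of_le_ofReal (by positivity) hνle
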